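/- arXiv:1810.10212 — 2 statements merged into one kernel-verified Lean document; each statement's English description precedes it below -/
import Mathlib

section
/- The function F is monotone increasing on the interval [π/4, π]. -/
open Real Set

/-- The denominator of `F` is positive on `(0, π]`. -/
lemma add_sin_mul_sin_sub_cos_pos {t : ℝ} (h0 : 0 < t) (hπ : t ≤ π) :
    0 < t + Real.sin t * (Real.sin t - Real.cos t) := by
  nlinarith [Real.sin_lt h0, Real.sin_nonneg_of_nonneg_of_le_pi h0.le hπ,
    Real.cos_le_one t, sq_nonneg (Real.sin t),
    mul_nonneg (Real.sin_nonneg_of_nonneg_of_le_pi h0.le hπ) (sub_nonneg.2 (Real.cos_le_one t))]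

lemma cos_le_sin_of_pi_div_four_le {t : ℝ} (h : π / 4 ≤ t) (hπ : t ≤ π) :
    Real.cos t ≤ Real.sin t := by
  have hpi := Real.pi_pos
  rcases le_total t (π / 2) with h2 | h2
  · rw [← Real.sin_pi_div_two_sub]
    exact Real.sin_le_sin_of_le_of_le_pi_div_two (by linarith) h2 (by linarith)
  · exact (Real.cos_nonpos_of_pi_div_two_le_of_le h2 (by linarith)).trans
      (Real.sin_nonneg_of_nonneg_of_le_pi (by linarith) hπ)

lemma mul_cos_le_sin {t : ℝ} (h0 : 0 ≤ t) (hπ : t ≤ π) :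
    t * Real.cos t ≤ Real.sin t := by
  have hpi := Real.pi_pos
  rcases lt_or_ge t (π / 2) with h2 | h2
  · have hc : 0 < Real.cos t := Real.cos_pos_of_mem_Ioo ⟨by linarith, h2⟩
    have ht := Real.le_tan h0 h2
    rwa [Real.tan_eq_sin_div_cos, le_div_iff₀ hc] at ht
  · exact (mul_nonpos_of_nonneg_of_nonpos h0
      (Real.cos_nonpos_of_pi_div_two_le_of_le h2 (by linarith))).trans
      (Real.sin_nonneg_of_nonneg_of_le_pi h0 hπ)

/-- The numerator of the derivative of `F` factors through `(sin t - cos t) * (sin t - t * cos t)`. -/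
lemma hasDerivAt_sq_div_add_sin_mul {t : ℝ}
    (h : t + Real.sin t * (Real.sin t - Real.cos t) ≠ 0) :
    HasDerivAt (fun x : ℝ ↦ x ^ 2 / (x + Real.sin x * (Real.sin x - Real.cos x)))
      (2 * t * ((Real.sin t - Real.cos t) * (Real.sin t - t * Real.cos t)) /
        (t + Real.sin t * (Real.sin t - Real.cos t)) ^ 2) t := by
  have hs := Real.hasDerivAt_sin t
  have hd := (hasDerivAt_id' t).add (hs.mul (hs.sub (Real.hasDerivAt_cos t)))
  refine (((hasDerivAt_id' t).pow 2).div hd h).congr_deriv ?_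
  simp only [Pi.add_apply, Pi.mul_apply, Pi.sub_apply, Pi.pow_apply]
  congr 1
  push_cast
  linear_combination (-t ^ 2) * Real.sin_sq_add_cos_sq t

/-- Define `F : [0, π] → ℝ` by `F 0 = 1` and
`F θ = θ² / (θ + sin θ * (sin θ - cos θ))` for `θ ∈ (0, π]`.
Then `F` is monotone increasing on `[π/4, π]`. -/
theorem stmt_2 (F : ℝ → ℝ) (hF0 : F 0 = 1)
    (hF : ∀ θ ∈ Set.Ioc (0 : ℝ) π,
      F θ = θ ^ 2 / (θ + Real.sin θ * (Real.sin θ - Real.cos θ))) :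
    MonotoneOn F (Set.Icc (π / 4) π) := by
  have hpos : ∀ {t : ℝ}, π / 4 ≤ t → 0 < t := fun h ↦ by linarith [Real.pi_pos]
  have hderiv : ∀ t ∈ Set.Icc (π / 4) π, _ := fun t ht ↦
    hasDerivAt_sq_div_add_sin_mul (add_sin_mul_sin_sub_cos_pos (hpos ht.1) ht.2).ne'
  have hmono : MonotoneOn (fun x : ℝ ↦ x ^ 2 / (x + Real.sin x * (Real.sin x - Real.cos x)))
      (Set.Icc (π / 4) π) := by
    refine monotoneOn_of_hasDerivWithinAt_nonneg (convex_Icc _ _)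
      (fun t ht ↦ (hderiv t ht).continuousAt.continuousWithinAt)
      (fun t ht ↦ (hderiv t (interior_subset ht)).hasDerivWithinAt) fun t ht ↦ ?_
    obtain ⟨h1, h2⟩ := interior_subset ht
    have ht0 := (hpos h1).le
    have hsc := sub_nonneg.2 (cos_le_sin_of_pi_div_four_le h1 h2)
    have hst := sub_nonneg.2 (mul_cos_le_sin ht0 h2)
    positivity
  exact hmono.congr fun t ht ↦ (hF t ⟨hpos ht.1, ht.2⟩).symm
end

section
/- Let x > 0 and z > 0 be real numbers and let θ ∈ (0, π) satisfy ν(θ) = 4z/x². Then (π/4)·(x² + 4z) ≤ (x·θ/sin θ)² ≤ π·(x² + 4z). -/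
open Real Set

/-- On `[0, π]` the function `sin t / t` is decreasing, in denominator-free form. -/
theorem mul_sin_le_mul_sin {a b : ℝ} (ha : 0 ≤ a) (hab : a ≤ b) (hb : b ≤ π) :
    a * sin b ≤ b * sin a := by
  rcases (ha.trans hab).eq_or_lt with rfl | hb0
  · simp [le_antisymm hab ha]
  have hab1 : 0 ≤ 1 - a / b := sub_nonneg.2 ((div_le_one hb0).2 hab)
  have h := strictConcaveOn_sin_Icc.concaveOn.2 ⟨hb0.le, hb⟩ ⟨le_rfl, pi_pos.le⟩
    (div_nonneg ha hb0.le) hab1 (by ring)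
  simp only [smul_eq_mul, mul_zero, sin_zero, add_zero, div_mul_cancel₀ a hb0.ne'] at h
  rw [div_mul_eq_mul_div, div_le_iff₀ hb0] at h
  linarith

theorem sqrt_two_mul_sin_pi_div_four : √2 * sin (π / 4) = 1 := by
  rw [sin_pi_div_four, ← mul_div_assoc, mul_self_sqrt zero_le_two]
  norm_num

/-- A parabola touching the graph of `√2 * cos` at `± π / 4` lies below it. -/
theorem one_add_sub_sq_le_sqrt_two_mul_cos (v : ℝ) :
    1 + π / 8 - 2 / π * v ^ 2 ≤ √2 * cos v := by
  wlog hv : 0 ≤ v generalizing v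
  · simpa using this (-v) (by linarith)
  have hπ := pi_pos
  have h2 : 0 ≤ √2 := sqrt_nonneg 2
  have hs := sqrt_two_mul_sin_pi_div_four
  have hd (u : ℝ) : HasDerivAt (fun u ↦ √2 * cos u + 2 / π * u ^ 2)
      (√2 * -sin u + 2 / π * (2 * u)) u := by
    convert! ((hasDerivAt_cos u).const_mul √2).add ((hasDerivAt_pow 2 u).const_mul (2 / π)) using 1
    simp
  have hcont : Continuous (fun u ↦ √2 * cos u + 2 / π * u ^ 2) := by fun_prop
  have heq : √2 * cos (π / 4) + 2 / π * (π / 4) ^ 2 = 1 + π / 8 := by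
    rw [cos_pi_div_four, ← sin_pi_div_four, hs]
    field_simp
    ring
  suffices √2 * cos (π / 4) + 2 / π * (π / 4) ^ 2 ≤ √2 * cos v + 2 / π * v ^ 2 by linarith
  have hlin (u : ℝ) : 2 / π * (2 * u) = u / (π / 4) := by
    field_simp
    ring
  rcases le_total v (π / 4) with hv4 | hv4
  · refine antitoneOn_of_deriv_nonpos (convex_Icc 0 (π / 4)) hcont.continuousOn
      (fun u _ ↦ (hd u).differentiableAt.differentiableWithinAt) (fun u hu ↦ ?_)
      ⟨hv, hv4⟩ ⟨by positivity, le_rfl⟩ hv4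
    rw [interior_Icc] at hu
    rw [(hd u).deriv, hlin]
    have h := mul_le_mul_of_nonneg_left
      (mul_sin_le_mul_sin hu.1.le hu.2.le (by linarith)) h2
    have : u / (π / 4) ≤ √2 * sin u := by
      rw [div_le_iff₀ (by positivity)]
      linear_combination h - u * hs
    linarith
  · refine monotoneOn_of_deriv_nonneg (convex_Ici (π / 4)) hcont.continuousOn
      (fun u _ ↦ (hd u).differentiableAt.differentiableWithinAt) (fun u hu ↦ ?_)
      self_mem_Ici hv4 hv4
    rw [interior_Ici, mem_Ioi] at hu
    rw [(hd u).deriv, hlin]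
    have : √2 * sin u ≤ u / (π / 4) := by
      rw [le_div_iff₀ (by positivity)]
      rcases le_total u π with huπ | huπ
      · have h := mul_le_mul_of_nonneg_left
          (mul_sin_le_mul_sin (by positivity) hu.le huπ) h2
        linear_combination h + u * hs
      · have hsin : √2 * sin u ≤ 2 :=
          (mul_le_of_le_one_right h2 (sin_le_one u)).trans
            (sqrt_le_iff.2 ⟨by norm_num, by norm_num⟩)
        nlinarith
    linarith

theorem pi_div_four_mul_le_sq (θ : ℝ) :
    π / 4 * (sin θ ^ 2 + (θ - sin θ * cos θ)) ≤ θ ^ 2 := by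
  have hπ := pi_pos
  have h := one_add_sub_sq_le_sqrt_two_mul_cos (2 * θ - π / 4)
  have hcos : √2 * cos (2 * θ - π / 4) = 1 - 2 * sin θ ^ 2 + 2 * sin θ * cos θ := by
    rw [cos_sub, cos_pi_div_four, ← sin_pi_div_four, cos_two_mul, sin_two_mul]
    linear_combination (2 * cos θ ^ 2 - 1 + 2 * sin θ * cos θ) * sqrt_two_mul_sin_pi_div_four
      + 2 * sin_sq_add_cos_sq θ
  rw [hcos] at h
  have h' := mul_le_mul_of_nonneg_left h hπ.le
  have hq : π * (1 + π / 8 - 2 / π * (2 * θ - π / 4) ^ 2)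
      = π + 4 * π * θ / 2 - 8 * θ ^ 2 := by
    field_simp
    ring
  rw [hq] at h'
  linarith

theorem sq_le_pi_mul {θ : ℝ} (h0 : 0 ≤ θ) (hθ : θ ≤ π) :
    θ ^ 2 ≤ π * (sin θ ^ 2 + (θ - sin θ * cos θ)) := by
  have hπ := pi_pos
  have hs : 0 ≤ sin θ := sin_nonneg_of_nonneg_of_le_pi h0 hθ
  suffices sin θ * (π * (cos θ - sin θ)) ≤ θ * (π - θ) by linarith
  have hc : π * (cos θ - sin θ) ≤ π - θ := by
    rcases le_total θ (π / 2) with h | h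
    · have hj := mul_le_mul_of_nonneg_left (mul_le_sin h0 h) hπ.le
      have hq : π * (2 / π * θ) = 2 * θ := by field_simp
      have := mul_le_mul_of_nonneg_left (cos_le_one θ) hπ.le
      linarith
    · have := cos_nonpos_of_pi_div_two_le_of_le h (by linarith)
      nlinarith
  calc sin θ * (π * (cos θ - sin θ)) ≤ sin θ * (π - θ) := mul_le_mul_of_nonneg_left hc hs
    _ ≤ θ * (π - θ) := mul_le_mul_of_nonneg_right (sin_le h0) (by linarith)

/-- Let `x > 0`, `z > 0` and let `θ ∈ (0, π)` satisfy `ν θ = 4z/x²`, where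
`ν θ = (θ - sin θ * cos θ) / sin² θ`. Then
`(π/4) * (x² + 4z) ≤ (x * θ / sin θ)² ≤ π * (x² + 4z)`. -/
theorem stmt_10 (x z θ : ℝ) (hx : 0 < x) (hz : 0 < z) (hθ : θ ∈ Set.Ioo (0 : ℝ) π)
    (hν : (θ - Real.sin θ * Real.cos θ) / Real.sin θ ^ 2 = 4 * z / x ^ 2) :
    π / 4 * (x ^ 2 + 4 * z) ≤ (x * θ / Real.sin θ) ^ 2 ∧
      (x * θ / Real.sin θ) ^ 2 ≤ π * (x ^ 2 + 4 * z) := by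
  have hs : 0 < sin θ := sin_pos_of_mem_Ioo hθ
  have hsum : x ^ 2 + 4 * z
      = x ^ 2 / sin θ ^ 2 * (sin θ ^ 2 + (θ - sin θ * cos θ)) := by
    rw [div_eq_div_iff (by positivity) (by positivity)] at hν
    field_simp
    linear_combination -hν
  have hsq : (x * θ / sin θ) ^ 2 = x ^ 2 / sin θ ^ 2 * θ ^ 2 := by
    rw [div_pow, mul_pow, mul_div_right_comm]
  have hk : 0 ≤ x ^ 2 / sin θ ^ 2 := by positivity
  rw [hsum, hsq, mul_left_comm, mul_left_comm π]
  exact ⟨mul_le_mul_of_nonneg_left (pi_div_four_mul_le_sq θ) hk,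
    mul_le_mul_of_nonneg_left (sq_le_pi_mul hθ.1.le hθ.2.le) hk⟩
end
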